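/- arXiv:1111.4388 — 2 statements merged into one kernel-verified Lean document; each statement's English description precedes it below -/
import Mathlib

section
/- For every real number α with 1 < α < 2 and every real λ with 0 < λ < 1, one has ∫₀^∞ ((1+x)^λ − 1 − λx) · x^{−1−α} dx = (λ(λ−1)/(α(α−1))) · ∫₁^∞ x^{λ−2}(x−1)^{1−α} dx, where both integrals converge absolutely. -/
open Real MeasureTheory Set

open Filter Topology

lemma integrableOn_Ioi_of_abs_le_rpow {h : ℝ → ℝ} {a b : ℝ} (ha : -1 < a) (hb : b < -1)
    (hc : ContinuousOn h (Ioi 0)) (h₀ : ∀ x > 0, |h x| ≤ x ^ a) (h₁ : ∀ x > 0, |h x| ≤ x ^ b) :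
    IntegrableOn h (Ioi 0) := by
  rw [← Ioc_union_Ioi_eq_Ioi (zero_le_one (α := ℝ))]
  refine IntegrableOn.union ?_ ?_
  · have hi : IntegrableOn (fun x : ℝ => x ^ a) (Ioc 0 1) :=
      (intervalIntegrable_iff_integrableOn_Ioc_of_le zero_le_one).1
        (intervalIntegral.intervalIntegrable_rpow' ha)
    refine Integrable.mono' hi
      ((hc.mono Ioc_subset_Ioi_self).aestronglyMeasurable measurableSet_Ioc) ?_
    filter_upwards [ae_restrict_mem measurableSet_Ioc] with x hx using h₀ x hx.1
  · refine Integrable.mono' (integrableOn_Ioi_rpow_of_lt hb one_pos)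
      ((hc.mono (Ioi_subset_Ioi zero_le_one)).aestronglyMeasurable measurableSet_Ioi) ?_
    filter_upwards [ae_restrict_mem measurableSet_Ioi] with x hx using h₁ x (one_pos.trans hx)

lemma tendsto_nhdsGT_zero_of_abs_le_rpow {h : ℝ → ℝ} {a : ℝ} (ha : 0 < a)
    (h₀ : ∀ x > 0, |h x| ≤ x ^ a) : Tendsto h (𝓝[>] 0) (𝓝 0) := by
  refine squeeze_zero_norm' (a := fun x : ℝ => x ^ a)
    (eventually_nhdsWithin_of_forall fun x hx => h₀ x hx) ?_
  have := (continuousAt_rpow_const (0 : ℝ) a (Or.inr ha.le)).tendsto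
  rw [zero_rpow ha.ne'] at this
  exact this.mono_left nhdsWithin_le_nhds

lemma tendsto_atTop_zero_of_abs_le_rpow {h : ℝ → ℝ} {b : ℝ} (hb : b < 0)
    (h₁ : ∀ x > 0, |h x| ≤ x ^ b) : Tendsto h atTop (𝓝 0) := by
  refine squeeze_zero_norm' (a := fun x : ℝ => x ^ b) ?_ ?_
  · filter_upwards [eventually_gt_atTop 0] with x hx using h₁ x hx
  · simpa using tendsto_rpow_neg_atTop (neg_pos.2 hb)

lemma abs_one_add_rpow_sub_le_self {lam x : ℝ} (h₁ : 0 < lam) (h₂ : lam < 1) (hx : 0 < x) :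
    |(1 + x) ^ lam - 1 - lam * x| ≤ x := by
  have := rpow_one_add_le_one_add_mul_self (s := x) (by linarith) h₁.le h₂.le
  have := one_le_rpow (x := 1 + x) (by linarith) h₁.le
  rw [abs_le]
  constructor <;> nlinarith

lemma abs_one_add_rpow_sub_le_sq {lam x : ℝ} (h₁ : 0 < lam) (h₂ : lam < 1) (hx : 0 < x) :
    |(1 + x) ^ lam - 1 - lam * x| ≤ x ^ 2 := by
  have hle := rpow_one_add_le_one_add_mul_self (s := x) (by linarith) h₁.le h₂.le
  have hle' := rpow_one_add_le_one_add_mul_self (s := x) (p := 1 - lam) (by linarith)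
    (by linarith) (by linarith)
  have hmul : (1 + x) ^ lam * (1 + x) ^ (1 - lam) = 1 + x := by
    rw [← rpow_add (by linarith)]; simp
  have hpos : 0 < (1 + x) ^ lam := by positivity
  have hden : 0 < 1 + (1 - lam) * x := by nlinarith
  have hprod : 1 + x ≤ (1 + x) ^ lam * (1 + (1 - lam) * x) :=
    hmul.symm.le.trans (mul_le_mul_of_nonneg_left hle' hpos.le)
  have hlow : 1 + lam * x - x ^ 2 ≤ (1 + x) ^ lam := by
    refine le_of_mul_le_mul_right (le_trans ?_ hprod) hden
    have : 0 ≤ x ^ 2 * (1 - lam * (1 - lam)) := by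
      apply mul_nonneg (sq_nonneg x); nlinarith
    have : 0 ≤ (1 - lam) * x ^ 3 := mul_nonneg (by linarith) (by positivity)
    nlinarith
  rw [abs_le]
  constructor <;> nlinarith [sq_nonneg x]

lemma abs_one_add_rpow_sub_one_le_one {lam x : ℝ} (h₂ : lam < 1) (hx : 0 < x) :
    |(1 + x) ^ (lam - 1) - 1| ≤ 1 := by
  have := rpow_le_one_of_one_le_of_nonpos (x := 1 + x) (z := lam - 1) (by linarith) (by linarith)
  have : 0 < (1 + x) ^ (lam - 1) := by positivity
  rw [abs_le]
  constructor <;> linarith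

lemma abs_one_add_rpow_sub_one_le_self {lam x : ℝ} (h₁ : 0 < lam) (h₂ : lam < 1) (hx : 0 < x) :
    |(1 + x) ^ (lam - 1) - 1| ≤ x := by
  have := rpow_le_one_of_one_le_of_nonpos (x := 1 + x) (z := lam - 1) (by linarith) (by linarith)
  have hle : (1 + x) ^ (-1 : ℝ) ≤ (1 + x) ^ (lam - 1) :=
    rpow_le_rpow_of_exponent_le (by linarith) (by linarith)
  have : 1 - x ≤ (1 + x) ^ (-1 : ℝ) := by
    rw [rpow_neg_one, ← one_div, le_div_iff₀ (by linarith)]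
    nlinarith
  rw [abs_le]
  constructor <;> linarith

lemma abs_mul_rpow_le {u x p q r : ℝ} (hx : 0 < x) (hu : |u| ≤ x ^ p) (hr : p + q = r) :
    |u * x ^ q| ≤ x ^ r := by
  rw [abs_mul, abs_of_pos (rpow_pos_of_pos hx q), ← hr, rpow_add hx]
  gcongr

theorem stmt_6 (α lam : ℝ) (hα₁ : 1 < α) (hα₂ : α < 2) (hlam₁ : 0 < lam) (hlam₂ : lam < 1) :
    IntegrableOn (fun x : ℝ => ((1 + x) ^ lam - 1 - lam * x) * x ^ (-1 - α)) (Ioi 0) volume ∧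
    IntegrableOn (fun x : ℝ => x ^ (lam - 2) * (x - 1) ^ (1 - α)) (Ioi 1) volume ∧
    ∫ x in Ioi (0 : ℝ), ((1 + x) ^ lam - 1 - lam * x) * x ^ (-1 - α)
      = (lam * (lam - 1) / (α * (α - 1))) * ∫ x in Ioi (1 : ℝ), x ^ (lam - 2) * (x - 1) ^ (1 - α) := by
  have hf₁ : ∀ x > 0, |(1 + x) ^ lam - 1 - lam * x| ≤ x ^ (1 : ℝ) := fun x hx => by
    simpa using abs_one_add_rpow_sub_le_self hlam₁ hlam₂ hx
  have hf₂ : ∀ x > (0 : ℝ), |(1 + x) ^ lam - 1 - lam * x| ≤ x ^ (2 : ℝ) := fun x hx => by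
    simpa using abs_one_add_rpow_sub_le_sq hlam₁ hlam₂ hx
  have hg₀ : ∀ x > (0 : ℝ), |(1 + x) ^ (lam - 1) - 1| ≤ x ^ (0 : ℝ) := fun x hx => by
    simpa using abs_one_add_rpow_sub_one_le_one hlam₂ hx
  have hg₁ : ∀ x > (0 : ℝ), |(1 + x) ^ (lam - 1) - 1| ≤ x ^ (1 : ℝ) := fun x hx => by
    simpa using abs_one_add_rpow_sub_one_le_self hlam₁ hlam₂ hx
  have hI : IntegrableOn (fun x : ℝ => ((1 + x) ^ lam - 1 - lam * x) * x ^ (-1 - α)) (Ioi 0) := by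
    refine integrableOn_Ioi_of_abs_le_rpow (a := 1 - α) (b := -α) (by linarith) (by linarith) ?_
      (fun x hx => abs_mul_rpow_le hx (hf₂ x hx) (by ring))
      (fun x hx => abs_mul_rpow_le hx (hf₁ x hx) (by ring))
    intro x (hx : 0 < x)
    have : 1 + x ≠ 0 := by positivity
    exact ContinuousAt.continuousWithinAt (by fun_prop (disch := grind))
  have hJ : IntegrableOn (fun x : ℝ => (1 + x) ^ (lam - 2) * x ^ (1 - α)) (Ioi 0) := by
    refine integrableOn_Ioi_of_abs_le_rpow (a := 1 - α) (b := lam - 1 - α)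
      (by linarith) (by linarith) ?_
      (fun x hx => abs_mul_rpow_le (p := 0) hx ?_ (by ring))
      (fun x hx => abs_mul_rpow_le (p := lam - 2) hx ?_ (by ring))
    · intro x (hx : 0 < x)
      have : 1 + x ≠ 0 := by positivity
      exact ContinuousAt.continuousWithinAt (by fun_prop (disch := grind))
    · rw [abs_of_pos (by positivity), rpow_zero]
      exact rpow_le_one_of_one_le_of_nonpos (by linarith) (by linarith)
    · rw [abs_of_pos (by positivity)]
      exact rpow_le_rpow_of_nonpos hx (by linarith) (by linarith)
  have hmp : MeasurePreserving (fun x : ℝ => 1 + x) := measurePreserving_add_left volume 1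
  have hme : MeasurableEmbedding (fun x : ℝ => 1 + x) := measurableEmbedding_addLeft 1
  have hpre : (fun x : ℝ => 1 + x) ⁻¹' Ioi 1 = Ioi 0 := by ext; simp
  have hJ' : IntegrableOn (fun x : ℝ => x ^ (lam - 2) * (x - 1) ^ (1 - α)) (Ioi 1) := by
    rw [← hmp.integrableOn_comp_preimage hme, hpre]
    simpa [Function.comp_def] using hJ
  refine ⟨hI, hJ', ?_⟩
  have hshift : ∫ x in Ioi (1 : ℝ), x ^ (lam - 2) * (x - 1) ^ (1 - α)
      = ∫ x in Ioi (0 : ℝ), (1 + x) ^ (lam - 2) * x ^ (1 - α) := by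
    rw [← hmp.setIntegral_preimage_emb hme, hpre]
    simp
  rw [hshift, ← sub_eq_zero, ← integral_const_mul, ← integral_sub hI (hJ.const_mul _)]
  have hα₀ : α ≠ 0 := by linarith
  have hα₁' : α - 1 ≠ 0 := by linarith
  let F : ℝ → ℝ := fun x => ((1 + x) ^ lam - 1 - lam * x) * x ^ (-α)
  let G : ℝ → ℝ := fun x => ((1 + x) ^ (lam - 1) - 1) * x ^ (1 - α)
  let H : ℝ → ℝ := fun x => -(1 / α) * F x - lam / (α * (α - 1)) * G x
  have hF₀ : ∀ x > 0, |F x| ≤ x ^ (2 - α) := fun x hx =>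
    abs_mul_rpow_le hx (hf₂ x hx) (by ring)
  have hF₁ : ∀ x > 0, |F x| ≤ x ^ (1 - α) := fun x hx =>
    abs_mul_rpow_le hx (hf₁ x hx) (by ring)
  have hG₀ : ∀ x > 0, |G x| ≤ x ^ (2 - α) := fun x hx =>
    abs_mul_rpow_le hx (hg₁ x hx) (by ring)
  have hG₁ : ∀ x > 0, |G x| ≤ x ^ (1 - α) := fun x hx =>
    abs_mul_rpow_le hx (hg₀ x hx) (by ring)
  have hH₀ : H 0 = 0 := by simp [H, F, G]
  have hH : ∀ l : Filter ℝ, Tendsto F l (𝓝 0) → Tendsto G l (𝓝 0) → Tendsto H l (𝓝 0) :=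
    fun l hF hG => by
      simpa [H] using (hF.const_mul (-(1 / α))).sub (hG.const_mul (lam / (α * (α - 1))))
  have hcont : ContinuousWithinAt H (Ici 0) 0 := by
    rw [← continuousWithinAt_Ioi_iff_Ici, ContinuousWithinAt, hH₀]
    exact hH _ (tendsto_nhdsGT_zero_of_abs_le_rpow (by linarith) hF₀)
      (tendsto_nhdsGT_zero_of_abs_le_rpow (by linarith) hG₀)
  have htop : Tendsto H atTop (𝓝 0) :=
    hH _ (tendsto_atTop_zero_of_abs_le_rpow (by linarith) hF₁)
      (tendsto_atTop_zero_of_abs_le_rpow (by linarith) hG₁)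
  have hderiv : ∀ x ∈ Ioi (0 : ℝ), HasDerivAt H (((1 + x) ^ lam - 1 - lam * x) * x ^ (-1 - α)
      - lam * (lam - 1) / (α * (α - 1)) * ((1 + x) ^ (lam - 2) * x ^ (1 - α))) x := by
    intro x (hx : 0 < x)
    have hadd : HasDerivAt (fun x : ℝ => 1 + x) 1 x := (hasDerivAt_id x).const_add 1
    have hne : 1 + x ≠ 0 := by positivity
    have hdF : HasDerivAt F _ x :=
      (((hadd.rpow_const (p := lam) (Or.inl hne)).sub_const 1).sub
        ((hasDerivAt_id x).const_mul lam)).mul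
        (hasDerivAt_rpow_const (p := -α) (Or.inl hx.ne'))
    have hdG : HasDerivAt G _ x :=
      ((hadd.rpow_const (p := lam - 1) (Or.inl hne)).sub_const 1).mul
        (hasDerivAt_rpow_const (p := 1 - α) (Or.inl hx.ne'))
    refine ((hdF.const_mul (-(1 / α))).sub (hdG.const_mul (lam / (α * (α - 1))))).congr_deriv ?_
    rw [show -α - 1 = -1 - α by ring, show 1 - α - 1 = -α by ring,
      show lam - 1 - 1 = lam - 2 by ring]
    simp only [id, Pi.sub_apply]
    field_simp
    ring
  rw [integral_Ioi_of_hasDerivAt_of_tendsto hcont hderiv (hI.sub (hJ.const_mul _)) htop, hH₀,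
    sub_zero]
end

section
/- Let α ∈ (1,2), β ∈ (1−1/α, 1), η := 1 − α(1−β) ∈ (0,1), and c_α := α(α−1)/Γ(2−α). Then for every z > 0, the integral ∫₀^∞ ((z + z^β x)^{1−η} − z^{1−η} − (1−η)·z^{β−η}·x) · c_α · x^{−1−α} dx converges and equals −(1−η)·Γ(αβ)/Γ(η); in particular its value does not depend on z. -/
open Real MeasureTheory Set
open Filter Topology Asymptotics

/-- The beta integral over `(0, 1)` for real parameters. -/
lemma integral_Ioo_rpow_mul_one_sub_rpow {a b : ℝ} (ha : 0 < a) (hb : 0 < b) :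
    ∫ x in Ioo (0 : ℝ) 1, x ^ (a - 1) * (1 - x) ^ (b - 1) =
      Real.Gamma a * Real.Gamma b / Real.Gamma (a + b) := by
  have h := ProbabilityTheory.beta_eq_betaIntegralReal a b ha hb
  rw [ProbabilityTheory.beta] at h
  rw [h, Complex.betaIntegral, intervalIntegral.integral_of_le (by norm_num),
    ← integral_Ioc_eq_integral_Ioo, ← RCLike.re_to_complex, ← integral_re]
  · refine setIntegral_congr_fun measurableSet_Ioc fun x ⟨hx₁, hx₂⟩ ↦ ?_
    norm_cast
    rw [← Complex.ofReal_cpow, ← Complex.ofReal_cpow, RCLike.re_to_complex,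
      Complex.re_mul_ofReal, Complex.ofReal_re]
    all_goals linarith
  convert! Complex.betaIntegral_convergent (u := a) (v := b) (by simpa) (by simpa)
  rw [intervalIntegrable_iff_integrableOn_Ioc_of_le (by simp), IntegrableOn]

/-- The beta integral over `(0, ∞)`. -/
lemma integral_Ioi_rpow_mul_one_add_rpow {a b : ℝ} (ha : 0 < a) (hb : 0 < b) :
    ∫ y in Ioi (0 : ℝ), y ^ (a - 1) * (1 + y) ^ (-(a + b)) =
      Real.Gamma a * Real.Gamma b / Real.Gamma (a + b) := by
  have himage : (fun y : ℝ => y / (1 + y)) '' Ioi 0 = Ioo 0 1 := by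
    ext x
    constructor
    · rintro ⟨y, hy, rfl⟩
      have hy : 0 < y := hy
      exact ⟨by positivity, by rw [div_lt_one (by positivity)]; linarith⟩
    · rintro ⟨h0, h1⟩
      have : 0 < 1 - x := by linarith
      refine ⟨x / (1 - x), mem_Ioi.2 (by positivity), ?_⟩
      simp only
      field_simp
      ring
  have hderiv : ∀ y ∈ Ioi (0 : ℝ), HasDerivWithinAt (fun y : ℝ => y / (1 + y))
      (1 / (1 + y) ^ 2) (Ioi 0) y := by
    intro y hy
    have hy : 0 < y := hy
    have := (hasDerivAt_id y).div ((hasDerivAt_id y).const_add 1)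
      (by simp only [id]; positivity)
    refine this.hasDerivWithinAt.congr_deriv ?_
    simp
  have hinj : InjOn (fun y : ℝ => y / (1 + y)) (Ioi 0) := by
    intro x hx y hy hxy
    have hx : 0 < x := hx
    have hy : 0 < y := hy
    simp only at hxy
    rw [div_eq_div_iff (by positivity) (by positivity)] at hxy
    linarith
  rw [← integral_Ioo_rpow_mul_one_sub_rpow ha hb, ← himage,
    integral_image_eq_integral_abs_deriv_smul measurableSet_Ioi hderiv hinj]
  refine setIntegral_congr_fun measurableSet_Ioi fun y hy => ?_
  have hy : 0 < y := hy
  have h1 : 0 < 1 + y := by positivity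
  have h2 : 1 - y / (1 + y) = (1 + y)⁻¹ := by field_simp; ring
  simp only [smul_eq_mul]
  rw [h2, div_rpow hy.le h1.le, inv_rpow h1.le, abs_of_pos (by positivity),
    show -(a + b) = -(a - 1) - (b - 1) - (2 : ℕ) by push_cast; ring,
    rpow_sub_natCast h1.ne', rpow_sub h1, rpow_neg h1.le]
  field_simp

lemma isBigO_rpow_of_norm_le {f : ℝ → ℝ} {C p : ℝ} (hf : ∀ y > 0, ‖f y‖ ≤ C * y ^ p)
    {l : Filter ℝ} (hl : ∀ᶠ y in l, 0 < y) : f =O[l] (· ^ p) :=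
  IsBigO.of_bound C <| hl.mono fun y hy => by
    rw [norm_of_nonneg (rpow_nonneg hy.le p)]
    exact hf y hy

lemma integrableOn_Ioi_mul_rpow_of_norm_le {f : ℝ → ℝ} {C D p q r : ℝ}
    (hfc : ContinuousOn f (Ioi 0)) (hp : ∀ y > 0, ‖f y‖ ≤ C * y ^ p)
    (hq : ∀ y > 0, ‖f y‖ ≤ D * y ^ q) (hpr : -1 < p + r) (hqr : q + r < -1) :
    IntegrableOn (fun y => f y * y ^ r) (Ioi 0) := by
  have := mellin_convergent_of_isBigO_scalar (a := -q) (b := -p) (s := r + 1)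
    (hfc.locallyIntegrableOn measurableSet_Ioi)
    (by simpa using isBigO_rpow_of_norm_le hq (eventually_gt_atTop 0)) (by linarith)
    (by
      rw [neg_neg]
      exact isBigO_rpow_of_norm_le hp (self_mem_nhdsWithin (s := Ioi 0)))
    (by linarith)
  simpa [mul_comm] using this

lemma tendsto_mul_rpow_nhdsGT_zero_of_norm_le {f : ℝ → ℝ} {C p r : ℝ}
    (hp : ∀ y > 0, ‖f y‖ ≤ C * y ^ p) (hpr : 0 < p + r) :
    Tendsto (fun y => f y * y ^ r) (𝓝[>] 0) (𝓝 0) := by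
  have h : Tendsto (fun y : ℝ => C * y ^ (p + r)) (𝓝[>] 0) (𝓝 0) := by
    have := ((continuousAt_rpow_const 0 (p + r) (Or.inr hpr.le)).tendsto.const_mul C).mono_left
      (nhdsWithin_le_nhds (s := Ioi 0))
    simpa [zero_rpow hpr.ne'] using this
  refine squeeze_zero_norm' ?_ h
  filter_upwards [self_mem_nhdsWithin] with y hy
  have hy : 0 < y := hy
  rw [norm_mul, norm_of_nonneg (rpow_nonneg hy.le r), rpow_add hy, ← mul_assoc]
  exact mul_le_mul_of_nonneg_right (hp y hy) (rpow_nonneg hy.le r)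

lemma tendsto_mul_rpow_atTop_of_norm_le {f : ℝ → ℝ} {D q r : ℝ}
    (hq : ∀ y > 0, ‖f y‖ ≤ D * y ^ q) (hqr : q + r < 0) :
    Tendsto (fun y => f y * y ^ r) atTop (𝓝 0) := by
  have h : Tendsto (fun y : ℝ => D * y ^ (q + r)) atTop (𝓝 0) := by
    have := (tendsto_rpow_neg_atTop (neg_pos.2 hqr)).const_mul D
    simpa using this
  refine squeeze_zero_norm' ?_ h
  filter_upwards [eventually_gt_atTop 0] with y hy
  rw [norm_mul, norm_of_nonneg (rpow_nonneg hy.le r), rpow_add hy, ← mul_assoc]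
  exact mul_le_mul_of_nonneg_right (hq y hy) (rpow_nonneg hy.le r)

/-- Integration by parts against a power on `(0, ∞)`, with vanishing boundary terms. -/
lemma integral_Ioi_mul_rpow_eq_of_norm_le {f f' : ℝ → ℝ} {C D p q r : ℝ} (hr : r + 1 ≠ 0)
    (hf : ∀ y > 0, HasDerivAt f (f' y) y)
    (hp : ∀ y > 0, ‖f y‖ ≤ C * y ^ p) (hq : ∀ y > 0, ‖f y‖ ≤ D * y ^ q)
    (hpr : -1 < p + r) (hqr : q + r < -1)
    (hf' : IntegrableOn (fun y => f' y * y ^ (r + 1)) (Ioi 0)) :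
    ∫ y in Ioi 0, f y * y ^ r = -(r + 1)⁻¹ * ∫ y in Ioi 0, f' y * y ^ (r + 1) := by
  have hfc : ContinuousOn f (Ioi 0) := fun y hy => (hf y hy).continuousAt.continuousWithinAt
  have hint := integrableOn_Ioi_mul_rpow_of_norm_le hfc hp hq hpr hqr
  have hv : ∀ y ∈ Ioi (0 : ℝ), HasDerivAt (fun y => y ^ (r + 1)) ((r + 1) * y ^ r) y := by
    intro y hy
    simpa using hasDerivAt_rpow_const (p := r + 1) (Or.inl (ne_of_gt hy))
  have key := integral_Ioi_mul_deriv_eq_deriv_mul (a := 0) (a' := 0) (b' := 0)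
    (u := f) (u' := f') (v := fun y => y ^ (r + 1)) (v' := fun y => (r + 1) * y ^ r)
    hf hv
    (by
      refine (hint.const_mul (r + 1)).congr (Eventually.of_forall fun y => ?_)
      simp only [Pi.mul_apply]
      ring)
    hf'
    (tendsto_mul_rpow_nhdsGT_zero_of_norm_le hp (by linarith))
    (tendsto_mul_rpow_atTop_of_norm_le hq (by linarith))
  have hpull : ∫ y in Ioi (0 : ℝ), f y * ((r + 1) * y ^ r) =
      (r + 1) * ∫ y in Ioi (0 : ℝ), f y * y ^ r := by
    rw [← integral_const_mul]
    congr 1 with y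
    ring
  rw [hpull] at key
  field_simp
  linarith

section TaylorRemainder

variable {s y : ℝ}

lemma norm_one_add_rpow_sub_one_le_one (hs : s ≤ 1) (hy : 0 ≤ y) :
    ‖(1 + y) ^ (s - 1) - 1‖ ≤ 1 := by
  have h1 : (1 + y) ^ (s - 1) ≤ 1 :=
    rpow_le_one_of_one_le_of_nonpos (by linarith) (by linarith)
  have h2 : 0 ≤ (1 + y) ^ (s - 1) := rpow_nonneg (by linarith) _
  rw [norm_eq_abs, abs_le]
  constructor <;> linarith

lemma norm_one_add_rpow_sub_one_le_self (hs₀ : 0 ≤ s) (hs : s ≤ 1) (hy : 0 ≤ y) :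
    ‖(1 + y) ^ (s - 1) - 1‖ ≤ y := by
  have h1 : (1 + y) ^ (s - 1) ≤ 1 :=
    rpow_le_one_of_one_le_of_nonpos (by linarith) (by linarith)
  have h2 : (1 + y)⁻¹ ≤ (1 + y) ^ (s - 1) := by
    rw [← rpow_neg_one]
    exact rpow_le_rpow_of_exponent_le (by linarith) (by linarith)
  have h3 : 1 - y ≤ (1 + y)⁻¹ := by
    rw [← one_div, le_div_iff₀ (by linarith)]
    nlinarith
  rw [norm_eq_abs, abs_le]
  constructor <;> linarith

lemma hasDerivAt_one_add_rpow (t : ℝ) (hy : 0 ≤ y) :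
    HasDerivAt (fun y : ℝ => (1 + y) ^ t) (t * (1 + y) ^ (t - 1)) y := by
  have := ((hasDerivAt_id y).const_add 1).rpow_const (p := t)
    (Or.inl (by simp only [id]; linarith))
  simpa using this

lemma hasDerivAt_taylorRemainder (hy : 0 ≤ y) :
    HasDerivAt (fun y : ℝ => (1 + y) ^ s - 1 - s * y) (s * ((1 + y) ^ (s - 1) - 1)) y := by
  have := ((hasDerivAt_one_add_rpow s hy).sub_const 1).sub ((hasDerivAt_id y).const_mul s)
  refine this.congr_deriv ?_
  ring

lemma norm_taylorRemainder_le {C : ℝ} (hs₀ : 0 ≤ s) (hy : 0 ≤ y)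
    (hC : ∀ t ∈ Icc 0 y, ‖(1 + t) ^ (s - 1) - 1‖ ≤ C) :
    ‖(1 + y) ^ s - 1 - s * y‖ ≤ s * C * y := by
  have := Convex.norm_image_sub_le_of_norm_hasDerivWithin_le (C := s * C)
    (f := fun y : ℝ => (1 + y) ^ s - 1 - s * y) (s := Icc 0 y)
    (fun t ht => (hasDerivAt_taylorRemainder ht.1).hasDerivWithinAt)
    (fun t ht => by
      rw [norm_mul, norm_of_nonneg hs₀]
      exact mul_le_mul_of_nonneg_left (hC t ht) hs₀)
    (convex_Icc 0 y) (left_mem_Icc.2 hy) (right_mem_Icc.2 hy)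
  simpa [abs_of_nonneg hy] using this

lemma integral_Ioi_taylorRemainder_mul_rpow {α : ℝ} (hα₁ : 1 < α) (hα₂ : α < 2)
    (hs₀ : 0 < s) (hs₁ : s < 1) :
    IntegrableOn (fun y : ℝ => ((1 + y) ^ s - 1 - s * y) * y ^ (-1 - α)) (Ioi 0) ∧
    ∫ y in Ioi (0 : ℝ), ((1 + y) ^ s - 1 - s * y) * y ^ (-1 - α) =
      -(s * Real.Gamma (2 - α) * Real.Gamma (α - s)) /
        (α * (α - 1) * Real.Gamma (1 - s)) := by
  have hG : ∀ y > (0 : ℝ), ‖(1 + y) ^ s - 1 - s * y‖ ≤ s * y ^ (2 : ℝ) := fun y hy => by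
    rw [rpow_two, sq, ← mul_assoc]
    exact norm_taylorRemainder_le hs₀.le hy.le fun t ht =>
      (norm_one_add_rpow_sub_one_le_self hs₀.le hs₁.le ht.1).trans ht.2
  have hG' : ∀ y > (0 : ℝ), ‖(1 + y) ^ s - 1 - s * y‖ ≤ (s * 1) * y ^ (1 : ℝ) := fun y hy => by
    rw [rpow_one]
    exact norm_taylorRemainder_le hs₀.le hy.le fun t ht =>
      norm_one_add_rpow_sub_one_le_one hs₁.le ht.1
  have hD : ∀ y > (0 : ℝ), ‖s * ((1 + y) ^ (s - 1) - 1)‖ ≤ s * y ^ (1 : ℝ) := fun y hy => by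
    rw [rpow_one, norm_mul, norm_of_nonneg hs₀.le]
    exact mul_le_mul_of_nonneg_left (norm_one_add_rpow_sub_one_le_self hs₀.le hs₁.le hy.le) hs₀.le
  have hD' : ∀ y > (0 : ℝ), ‖s * ((1 + y) ^ (s - 1) - 1)‖ ≤ s * y ^ (0 : ℝ) := fun y hy => by
    rw [rpow_zero, norm_mul, norm_of_nonneg hs₀.le]
    exact mul_le_mul_of_nonneg_left (norm_one_add_rpow_sub_one_le_one hs₁.le hy.le) hs₀.le
  have hE : ∀ y > (0 : ℝ), ‖(1 + y) ^ (s - 2)‖ ≤ 1 * y ^ (0 : ℝ) := fun y hy => by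
    rw [rpow_zero, norm_of_nonneg (by positivity), mul_one]
    exact rpow_le_one_of_one_le_of_nonpos (by linarith) (by linarith)
  have hE' : ∀ y > (0 : ℝ), ‖(1 + y) ^ (s - 2)‖ ≤ 1 * y ^ (s - 2) := fun y hy => by
    rw [norm_of_nonneg (by positivity), one_mul]
    exact rpow_le_rpow_of_nonpos hy (by linarith) (by linarith)
  have hderiv : ∀ y > (0 : ℝ), HasDerivAt (fun y : ℝ => (1 + y) ^ s - 1 - s * y)
      (s * ((1 + y) ^ (s - 1) - 1)) y := fun y hy => hasDerivAt_taylorRemainder hy.le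
  have hderiv' : ∀ y > (0 : ℝ), HasDerivAt (fun y : ℝ => s * ((1 + y) ^ (s - 1) - 1))
      (s * ((s - 1) * (1 + y) ^ (s - 2))) y := fun y hy => by
    have := ((hasDerivAt_one_add_rpow (s - 1) hy.le).sub_const 1).const_mul s
    refine this.congr_deriv ?_
    ring_nf
  have hintE : IntegrableOn (fun y : ℝ => s * ((s - 1) * (1 + y) ^ (s - 2)) *
      y ^ (-1 - α + 1 + 1)) (Ioi 0) := by
    have := (integrableOn_Ioi_mul_rpow_of_norm_le (r := -1 - α + 1 + 1)
      (fun y (hy : 0 < y) =>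
        (hasDerivAt_one_add_rpow (s - 2) hy.le).continuousAt.continuousWithinAt)
      hE hE' (by linarith) (by linarith)).const_mul (s * (s - 1))
    refine this.congr (Eventually.of_forall fun y => ?_)
    simp only
    ring
  have hintD : IntegrableOn (fun y : ℝ => s * ((1 + y) ^ (s - 1) - 1) *
      y ^ (-1 - α + 1)) (Ioi 0) :=
    integrableOn_Ioi_mul_rpow_of_norm_le
      (fun y hy => (hderiv' y hy).continuousAt.continuousWithinAt)
      hD hD' (by linarith) (by linarith)
  refine ⟨integrableOn_Ioi_mul_rpow_of_norm_le
    (fun y hy => (hderiv y hy).continuousAt.continuousWithinAt)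
    hG hG' (by linarith) (by linarith), ?_⟩
  have hbeta : ∫ y in Ioi (0 : ℝ), s * ((s - 1) * (1 + y) ^ (s - 2)) * y ^ (-1 - α + 1 + 1) =
      s * (s - 1) * (Real.Gamma (2 - α) * Real.Gamma (α - s) / Real.Gamma (2 - s)) := by
    have := integral_Ioi_rpow_mul_one_add_rpow (a := 2 - α) (b := α - s)
      (by linarith) (by linarith)
    rw [show 2 - α + (α - s) = 2 - s by ring] at this
    rw [← this, ← integral_const_mul]
    congr 1 with y
    rw [show -1 - α + 1 + 1 = 2 - α - 1 by ring, show -(2 - s) = s - 2 by ring]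
    ring
  rw [integral_Ioi_mul_rpow_eq_of_norm_le (by linarith) hderiv hG hG' (by linarith)
      (by linarith) hintD,
    integral_Ioi_mul_rpow_eq_of_norm_le (by linarith) hderiv' hD hD' (by linarith)
      (by linarith) hintE,
    hbeta, show 2 - s = (1 - s) + 1 by ring, Real.Gamma_add_one (by linarith),
    show -1 - α + 1 + 1 = -(α - 1) by ring, show -1 - α + 1 = -α by ring]
  have h1 : Real.Gamma (1 - s) ≠ 0 := (Real.Gamma_pos_of_pos (by linarith)).ne'
  have h2 : 1 - s ≠ 0 := by linarith
  have h3 : α - 1 ≠ 0 := by linarith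
  have h4 : α ≠ 0 := by linarith
  field_simp
  ring

end TaylorRemainder

theorem stmt_17 (α β η : ℝ) (hα₁ : 1 < α) (hα₂ : α < 2) (hβ₁ : 1 - 1 / α < β) (hβ₂ : β < 1)
    (hη : η = 1 - α * (1 - β)) (z : ℝ) (hz : 0 < z) :
    IntegrableOn
      (fun x : ℝ => ((z + z ^ β * x) ^ (1 - η) - z ^ (1 - η) - (1 - η) * z ^ (β - η) * x) *
        (α * (α - 1) / Real.Gamma (2 - α)) * x ^ (-1 - α)) (Ioi 0) volume ∧
    ∫ x in Ioi (0 : ℝ),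
        ((z + z ^ β * x) ^ (1 - η) - z ^ (1 - η) - (1 - η) * z ^ (β - η) * x) *
          (α * (α - 1) / Real.Gamma (2 - α)) * x ^ (-1 - α)
      = -(1 - η) * Real.Gamma (α * β) / Real.Gamma η := by
  have hα₀ : 0 < α := by linarith
  have hs₀ : 0 < 1 - η := by rw [hη]; nlinarith
  have hs₁ : 1 - η < 1 := by
    have : α * (1 - β) < α * (1 / α) := mul_lt_mul_of_pos_left (by linarith) hα₀
    rw [mul_one_div_cancel hα₀.ne'] at this
    linarith
  obtain ⟨hint, hval⟩ := integral_Ioi_taylorRemainder_mul_rpow hα₁ hα₂ hs₀ hs₁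
  set K := α * (α - 1) / Real.Gamma (2 - α) with hK
  set c := z ^ (β - 1) with hc
  have hc₀ : 0 < c := rpow_pos_of_pos hz _
  have hzβ : z ^ β = z * c := by
    rw [hc, mul_comm, ← rpow_add_one hz.ne']
    ring_nf
  have hzβη : z ^ (β - η) = z ^ (1 - η) * c := by
    rw [hc, ← rpow_add hz]
    ring_nf
  have hcα : z ^ (1 - η) * c ^ α = 1 := by
    rw [hc, ← rpow_mul hz.le, ← rpow_add hz, hη]
    ring_nf
    exact rpow_zero z
  let F : ℝ → ℝ := fun y => ((1 + y) ^ (1 - η) - 1 - (1 - η) * y) * y ^ (-1 - α)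
  have hEq : EqOn (fun x : ℝ => ((z + z ^ β * x) ^ (1 - η) - z ^ (1 - η) -
      (1 - η) * z ^ (β - η) * x) * K * x ^ (-1 - α)) (fun x => K * c * F (c * x)) (Ioi 0) := by
    intro x hx
    have hx : 0 < x := hx
    have hcx : c * c ^ (-1 - α) = z ^ (1 - η) := by
      rw [show -1 - α = -α - 1 by ring, rpow_sub_one hc₀.ne', rpow_neg hc₀.le]
      field_simp
      linarith
    simp only [F]
    rw [hzβ, hzβη, show z + z * c * x = z * (1 + c * x) by ring,
      mul_rpow hz.le (by positivity), mul_rpow hc₀.le hx.le, ← hcx]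
    ring
  have hintc : IntegrableOn (fun x => F (c * x)) (Ioi 0) :=
    (integrableOn_Ioi_comp_mul_left_iff F 0 hc₀).2 (by simpa using hint)
  refine ⟨IntegrableOn.congr_fun (hintc.const_mul (K * c)) hEq.symm measurableSet_Ioi, ?_⟩
  rw [setIntegral_congr_fun measurableSet_Ioi hEq, integral_const_mul,
    integral_comp_mul_left_Ioi F 0 hc₀, mul_zero, hval, smul_eq_mul, hK,
    show α - (1 - η) = α * β by rw [hη]; ring, show 1 - (1 - η) = η by ring]
  have h1 : Real.Gamma (2 - α) ≠ 0 := (Real.Gamma_pos_of_pos (by linarith)).ne'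
  have h2 : Real.Gamma η ≠ 0 := (Real.Gamma_pos_of_pos (by linarith)).ne'
  have h3 : α - 1 ≠ 0 := by linarith
  field_simp
end
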